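/- For a non-exceptional semigroup S of polynomials, the following are equivalent: (1) S is right amenable; (2) every subsemigroup of S is right amenable; (3) every subsemigroup of S generated by two elements is right amenable. -/

import Mathlib

/-- A real-valued function on `σ` is bounded. -/
def Bdd {σ : Type*} (f : σ → ℝ) : Prop := ∃ C : ℝ, ∀ s, |f s| ≤ C

/-- A mean on `σ`: a normalized positive real-linear functional on the space `ℓ∞(σ)`
of bounded real-valued functions on `σ`. -/
structure Mean (σ : Type*) where
  toFun : (σ → ℝ) → ℝ
  map_add' : ∀ f g : σ → ℝ, Bdd f → Bdd g → toFun (f + g) = toFun f + toFun g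
  map_smul' : ∀ (c : ℝ) (f : σ → ℝ), Bdd f → toFun (c • f) = c * toFun f
  nonneg' : ∀ f : σ → ℝ, Bdd f → (∀ s, 0 ≤ f s) → 0 ≤ toFun f
  one' : toFun (fun _ => (1 : ℝ)) = 1

/-- `M` is a left invariant mean on a set `S` of polynomials, regarded as a semigroup
with product `g·h := g ∘ h` (polynomial composition):  `M (g ↦ f (h ∘ g)) = M f`. -/
def PolyLeftInv (S : Set (Polynomial ℂ)) (M : Mean S) : Prop :=
  ∀ (h : S) (hc : ∀ g : S, (h : Polynomial ℂ).comp (g : Polynomial ℂ) ∈ S),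
    ∀ f : S → ℝ, Bdd f →
      M.toFun (fun g : S => f ⟨(h : Polynomial ℂ).comp (g : Polynomial ℂ), hc g⟩) = M.toFun f

/-- `M` is a right invariant mean on a set `S` of polynomials under composition:
`M (g ↦ f (g ∘ h)) = M f`. -/
def PolyRightInv (S : Set (Polynomial ℂ)) (M : Mean S) : Prop :=
  ∀ (h : S) (hc : ∀ g : S, (g : Polynomial ℂ).comp (h : Polynomial ℂ) ∈ S),
    ∀ f : S → ℝ, Bdd f →
      M.toFun (fun g : S => f ⟨(g : Polynomial ℂ).comp (h : Polynomial ℂ), hc g⟩) = M.toFun f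

/-- The affine conjugate `σ ∘ P ∘ σ⁻¹` of `P` by `σ(z) = a z + b` (with
`σ⁻¹(z) = a⁻¹ (z - b)`), as a polynomial. -/
noncomputable def affConj (a b : ℂ) (P : Polynomial ℂ) : Polynomial ℂ :=
  ((Polynomial.C a * Polynomial.X + Polynomial.C b).comp P).comp
    (Polynomial.C a⁻¹ * (Polynomial.X - Polynomial.C b))

/-- A polynomial is exceptional if it has degree at most one, or is affinely conjugate
to the power map `z ↦ z^{deg P}` or to `± T_{deg P}` where `T_n` is the degree-`n`
Chebyshev polynomial. -/
def IsExceptional (P : Polynomial ℂ) : Prop :=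
  P.natDegree ≤ 1 ∨
  ∃ a b : ℂ, a ≠ 0 ∧
    (affConj a b P = Polynomial.X ^ P.natDegree ∨
     affConj a b P = Polynomial.Chebyshev.T ℂ (P.natDegree : ℤ) ∨
     affConj a b P = -Polynomial.Chebyshev.T ℂ (P.natDegree : ℤ))

/-- The subsemigroup (under polynomial composition) generated by a set `G` of
polynomials: the smallest set containing `G` and closed under composition. -/
inductive PolyGen (G : Set (Polynomial ℂ)) : Polynomial ℂ → Prop
  | base {p : Polynomial ℂ} (hp : p ∈ G) : PolyGen G p
  | comp {p q : Polynomial ℂ} (hp : PolyGen G p) (hq : PolyGen G q) : PolyGen G (p.comp q)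

open Filter Topology in
/-- Averages along a Følner net converge along an ultrafilter to an invariant mean. -/
theorem Mean.exists_invariant_of_folner {σ ι : Type*} (r : ι → σ → σ)
    (hr : ∀ h, Function.Injective (r h))
    (hF : ∀ (H : Finset ι) (ε : ℝ), 0 < ε → ∃ F F' : Finset σ, F.Nonempty ∧ F ⊆ F' ∧
      (∀ h ∈ H, ∀ g ∈ F, r h g ∈ F') ∧ (F'.card : ℝ) ≤ (1 + ε) * F.card) :
    ∃ M : Mean σ, ∀ h (f : σ → ℝ), Bdd f → M.toFun (fun g => f (r h g)) = M.toFun f := by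
  classical
  choose F F' hne hsub hmem hcard using fun i : Finset ι × ℕ =>
    hF i.1 (1 / ((i.2 : ℝ) + 1)) (by positivity)
  let U : Ultrafilter (Finset ι × ℕ) := Ultrafilter.of atTop
  have hU : (U : Filter (Finset ι × ℕ)) ≤ atTop := Ultrafilter.of_le _
  let avg : (σ → ℝ) → Finset ι × ℕ → ℝ := fun f i => (∑ g ∈ F i, f g) / (F i).card
  have hpos : ∀ i, (0 : ℝ) < (F i).card := fun i => by exact_mod_cast (hne i).card_pos
  have hsum : ∀ (f : σ → ℝ) (C : ℝ), (∀ s, |f s| ≤ C) → ∀ A : Finset σ,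
      |∑ g ∈ A, f g| ≤ C * A.card := fun f C hC A => by
    refine (Finset.abs_sum_le_sum_abs _ _).trans ?_
    refine (Finset.sum_le_card_nsmul A _ C fun x _ => hC x).trans ?_
    rw [nsmul_eq_mul, mul_comm]
  have hlim : ∀ f, Bdd f → Tendsto (avg f) U (𝓝 (limUnder U (avg f))) := by
    rintro f ⟨C, hC⟩
    refine tendsto_nhds_limUnder ?_
    have hI : ∀ i, avg f i ∈ Set.Icc (-C) C := fun i => by
      rw [Set.mem_Icc, ← abs_le, abs_div, abs_of_pos (hpos i), div_le_iff₀ (hpos i)]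
      exact hsum f C hC _
    obtain ⟨x, -, hx⟩ := isCompact_Icc.ultrafilter_le_nhds (U.map (avg f))
      (le_principal_iff.2 (Filter.mem_map.2 (Filter.univ_mem' hI)))
    exact ⟨x, hx⟩
  have hbshift : ∀ h f, Bdd f → Bdd fun g => f (r h g) := fun h f ⟨C, hC⟩ => ⟨C, fun s => hC _⟩
  refine ⟨⟨fun f => limUnder U (avg f), ?_, ?_, ?_, ?_⟩, ?_⟩
  · rintro f g hf hg
    have := (hlim f hf).add (hlim g hg)
    refine Tendsto.limUnder_eq (this.congr fun i => ?_)
    simp [avg, Finset.sum_add_distrib, add_div]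
  · rintro c f hf
    refine Tendsto.limUnder_eq (((hlim f hf).const_mul c).congr fun i => ?_)
    simp [avg, Finset.mul_sum, mul_div_assoc']
  · rintro f hf h0
    refine ge_of_tendsto' (hlim f hf) fun i => ?_
    exact div_nonneg (Finset.sum_nonneg fun x _ => h0 x) (hpos i).le
  · refine Tendsto.limUnder_eq (tendsto_const_nhds.congr fun i => ?_)
    simp [avg, (hpos i).ne']
  · rintro h f hf
    obtain ⟨C, hC⟩ := id hf
    have hzero : Tendsto (fun i => avg (fun g => f (r h g)) i - avg f i) U (𝓝 0) := by
      have hlim0 : Tendsto (fun i : Finset ι × ℕ => 2 * C * (1 / ((i.2 : ℝ) + 1))) U (𝓝 0) := by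
        have : Tendsto (fun i : Finset ι × ℕ => i.2) U atTop :=
          (tendsto_snd.mono_left (by rw [prod_atTop_atTop_eq])).mono_left hU
        simpa using (tendsto_one_div_add_atTop_nhds_zero_nat.comp this).const_mul (2 * C)
      refine squeeze_zero_norm' ?_ hlim0
      have hev : ∀ᶠ i in (U : Filter (Finset ι × ℕ)), ({h}, 0) ≤ i := hU (eventually_ge_atTop _)
      filter_upwards [hev] with i hi
      have hhi : h ∈ i.1 := hi.1 (by simp)
      have himg : (F i).image (r h) ⊆ F' i := by
        intro x hx
        obtain ⟨g, hg, rfl⟩ := Finset.mem_image.1 hx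
        exact hmem i h hhi g hg
      have hcimg : ((F i).image (r h)).card = (F i).card :=
        Finset.card_image_of_injective _ (hr h)
      have e1 : ∑ g ∈ F i, f (r h g) = ∑ g ∈ (F i).image (r h), f g :=
        (Finset.sum_image fun x _ y _ hxy => hr h hxy).symm
      have e2 := Finset.sum_sdiff (f := f) himg
      have e3 := Finset.sum_sdiff (f := f) (hsub i)
      have c2 : ((F' i \ (F i).image (r h)).card : ℝ) = (F' i).card - (F i).card := by
        rw [Finset.card_sdiff_of_subset himg, hcimg,
          Nat.cast_sub (Finset.card_le_card (hsub i))]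
      have c3 : ((F' i \ F i).card : ℝ) = (F' i).card - (F i).card := by
        rw [Finset.card_sdiff_of_subset (hsub i), Nat.cast_sub (Finset.card_le_card (hsub i))]
      have b2 := hsum f C hC (F' i \ (F i).image (r h))
      have b3 := hsum f C hC (F' i \ F i)
      rw [c2] at b2
      rw [c3] at b3
      have hC0 : 0 ≤ C := (abs_nonneg _).trans (hC (hne i).choose)
      have hc := hcard i
      rw [Real.norm_eq_abs, ← sub_div, abs_div, abs_of_pos (hpos i), div_le_iff₀ (hpos i), e1]
      have hd : (∑ g ∈ (F i).image (r h), f g) - ∑ g ∈ F i, f g =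
          (∑ g ∈ F' i \ F i, f g) - ∑ g ∈ F' i \ (F i).image (r h), f g := by linarith
      rw [hd]
      refine (abs_sub _ _).trans ?_
      have : C * ((F' i).card - (F i).card : ℝ) ≤ C * (1 / ((i.2 : ℝ) + 1) * (F i).card) :=
        mul_le_mul_of_nonneg_left (by linarith) hC0
      linarith
    have := hzero.add (hlim f hf)
    rw [zero_add] at this
    exact Tendsto.limUnder_eq (this.congr fun i => by ring)

open Filter Topology in
/-- A positive sequence bounded by a polynomial has consecutive ratios arbitrarily close to one. -/
theorem exists_succ_le_of_polynomial_growth (u : ℕ → ℕ) (hu : ∀ K, 0 < u K) (C k : ℕ)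
    (hb : ∀ K, u K ≤ C * (K + 2) ^ k) (ε : ℝ) (hε : 0 < ε) :
    ∃ K, (u (K + 1) : ℝ) ≤ (1 + ε) * u K := by
  by_contra! hcon
  have hlow : ∀ K, (1 + ε) ^ K ≤ (u K : ℝ) := by
    intro K
    induction K with
    | zero => simpa using Nat.succ_le_of_lt (hu 0)
    | succ K ih =>
      rw [pow_succ']
      exact (mul_le_mul_of_nonneg_left ih (by positivity)).trans (hcon K).le
  have ht := tendsto_pow_const_div_const_pow_of_one_lt k (by linarith : (1 : ℝ) < 1 + ε)
  have ht2 := ((tendsto_add_atTop_iff_nat 2).2 ht).const_mul (C * (1 + ε) ^ 2)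
  rw [mul_zero] at ht2
  obtain ⟨K, hK⟩ := (ht2.eventually (gt_mem_nhds one_pos)).exists
  have h1 : (1 + ε) ^ K ≤ (C : ℝ) * (K + 2) ^ k := (hlow K).trans (by exact_mod_cast hb K)
  have hp : (0 : ℝ) < (1 + ε) ^ K := by positivity
  rw [pow_add, mul_div_assoc', div_lt_one (by positivity)] at hK
  push_cast at hK
  nlinarith [pow_pos (by linarith : (0 : ℝ) < 1 + ε) 2]

theorem Polynomial.comp_right_injective {R : Type*} [CommRing R] [IsDomain R]
    {h : Polynomial R} (hh : 0 < h.natDegree) :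
    Function.Injective fun p : Polynomial R => p.comp h := by
  intro p q hpq
  have h0 : (p - q).comp h = 0 := by
    rw [Polynomial.sub_comp]
    exact sub_eq_zero.2 hpq
  rcases Polynomial.comp_eq_zero_iff.1 h0 with h1 | ⟨-, h1⟩
  · exact sub_eq_zero.1 h1
  · rw [h1, Polynomial.natDegree_C] at hh
    exact absurd hh (lt_irrefl _)

/-- A right amenable semigroup of polynomials is right reversible. -/
theorem PolyRightInv.exists_comp_eq_comp {T : Set (Polynomial ℂ)} {M : Mean T}
    (hM : PolyRightInv T M) (hT : ∀ p ∈ T, ∀ q ∈ T, p.comp q ∈ T)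
    {a b : Polynomial ℂ} (ha : a ∈ T) (hb : b ∈ T) :
    ∃ x ∈ T, ∃ y ∈ T, x.comp a = y.comp b := by
  classical
  by_contra! hcon
  let f : Polynomial ℂ → T → ℝ := fun c s => if ∃ x ∈ T, x.comp c = s then 1 else 0
  have hbd : ∀ c, Bdd (f c) := fun c => ⟨1, fun s => by
    dsimp only [f]
    split_ifs <;> simp⟩
  have hone : ∀ c ∈ T, M.toFun (f c) = 1 := fun c hc => by
    rw [← hM ⟨c, hc⟩ (fun g => hT _ g.2 _ hc) (f c) (hbd c), ← M.one']
    congr 1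
    funext g
    exact if_pos ⟨g, g.2, rfl⟩
  let d : T → ℝ := fun s => 1 - (f a s + f b s)
  have hd0 : ∀ s, 0 ≤ d s := fun s => by
    dsimp only [d, f]
    split_ifs with h1 h2 h2 <;> norm_num
    obtain ⟨x, hx, hxs⟩ := h1
    obtain ⟨y, hy, hys⟩ := h2
    exact hcon x hx y hy (hxs.trans hys.symm)
  have hd1 : ∀ s, d s ≤ 1 := fun s => by
    dsimp only [d, f]
    split_ifs <;> norm_num
  have hdb : Bdd d := ⟨1, fun s => by rw [abs_of_nonneg (hd0 s)]; exact hd1 s⟩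
  have hab : Bdd (f a + f b) := ⟨2, fun s => by
    simp only [Pi.add_apply, f]
    split_ifs <;> norm_num⟩
  have h1 := M.map_add' d (f a + f b) hdb hab
  have h2 : d + (f a + f b) = fun _ => (1 : ℝ) := by
    funext s
    simp [d]
  rw [h2, M.one', M.map_add' _ _ (hbd a) (hbd b), hone a ha, hone b hb] at h1
  have := M.nonneg' d hdb hd0
  linarith

open Polynomial in
theorem Polynomial.natDegree_eraseLead_comp_le {R : Type*} [CommRing R]
    (x a : R[X]) : (x.eraseLead.comp a).natDegree ≤ (x.natDegree - 1) * a.natDegree :=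
  natDegree_comp_le.trans (Nat.mul_le_mul_right _ (eraseLead_natDegree_le _))

open Polynomial in
/-- Two polynomials of the same degree and leading coefficient with a common left composite by
polynomials with equal leading coefficient differ by a constant. -/
theorem Polynomial.natDegree_sub_eq_zero_of_comp_eq_comp {R : Type*} [CommRing R] [IsDomain R]
    [CharZero R] {x y a b : R[X]} (hx : 0 < x.natDegree) (hxy : x.natDegree = y.natDegree)
    (hlxy : x.leadingCoeff = y.leadingCoeff) (ha : 0 < a.natDegree)
    (hab : a.natDegree = b.natDegree)
    (hlab : a.leadingCoeff = b.leadingCoeff) (h : x.comp a = y.comp b) :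
    (a - b).natDegree = 0 := by
  by_contra hne
  set m := x.natDegree with hm
  set n := a.natDegree with hn
  set G : R[X] := ∑ i ∈ Finset.range m, a ^ i * b ^ (m - 1 - i) with hG
  have ha0 : a.leadingCoeff ≠ 0 := by
    rw [Ne, leadingCoeff_eq_zero]
    rintro rfl
    simp [hn] at ha
  have hcoef : G.coeff ((m - 1) * n) = m * a.leadingCoeff ^ (m - 1) := by
    rw [hG, finsetSum_coeff]
    have : ∀ i ∈ Finset.range m, (a ^ i * b ^ (m - 1 - i)).coeff ((m - 1) * n) =
        a.leadingCoeff ^ (m - 1) := by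
      intro i hi
      have hi' := Finset.mem_range.1 hi
      have hsplit : (m - 1) * n = i * n + (m - 1 - i) * n := by
        rw [← add_mul]
        congr 1
        omega
      rw [hsplit, coeff_mul_add_eq_of_natDegree_le (natDegree_pow_le)
        ((natDegree_pow_le).trans (by rw [hab])), coeff_pow_of_natDegree_le le_rfl,
        coeff_pow_of_natDegree_le hab.ge, hab, ← hab, coeff_natDegree, hab, coeff_natDegree,
        ← hlab, ← pow_add]
      congr 1
      omega
    rw [Finset.sum_congr rfl this, Finset.sum_const, Finset.card_range, nsmul_eq_mul]
  have hG0 : G.coeff ((m - 1) * n) ≠ 0 := by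
    rw [hcoef]
    exact mul_ne_zero (Nat.cast_ne_zero.2 hx.ne') (pow_ne_zero _ ha0)
  have hGne : G ≠ 0 := by
    intro h0
    simp [h0] at hG0
  have hsubne : a - b ≠ 0 := by
    intro h0
    simp [h0] at hne
  have hx0 : x.leadingCoeff ≠ 0 := by
    rw [Ne, leadingCoeff_eq_zero]
    rintro rfl
    simp [hm] at hx
  have key : C x.leadingCoeff * (G * (a - b)) = y.eraseLead.comp b - x.eraseLead.comp a := by
    have h1 : x.comp a = x.eraseLead.comp a + C x.leadingCoeff * a ^ m := by
      conv_lhs => rw [← eraseLead_add_C_mul_X_pow x]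
      rw [add_comp, mul_comp, C_comp, X_pow_comp]
    have h2 : y.comp b = y.eraseLead.comp b + C x.leadingCoeff * b ^ m := by
      conv_lhs => rw [← eraseLead_add_C_mul_X_pow y]
      rw [add_comp, mul_comp, C_comp, X_pow_comp, hlxy, hxy]
    rw [hG, (Commute.all a b).geom_sum₂_mul]
    rw [h1, h2] at h
    linear_combination h
  have hdeg : (C x.leadingCoeff * (G * (a - b))).natDegree ≤ (m - 1) * n := by
    rw [key]
    refine (natDegree_sub_le _ _).trans (max_le ?_ (natDegree_eraseLead_comp_le x a))
    simpa [← hxy, ← hab] using natDegree_eraseLead_comp_le y b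
  rw [natDegree_C_mul hx0, natDegree_mul hGne hsubne] at hdeg
  have := le_natDegree_of_ne_zero hG0
  omega

open Polynomial in
theorem Polynomial.exists_eq_C_mul_add_C_of_comp_eq_comp {K : Type*} [Field K] [CharZero K]
    {x y a b : K[X]} (hx : 0 < x.natDegree) (ha : 0 < a.natDegree)
    (hab : a.natDegree = b.natDegree) (h : x.comp a = y.comp b) :
    ∃ α β : K, a = C α * b + C β := by
  have hxy : x.natDegree = y.natDegree := by
    have := congrArg natDegree h
    rw [natDegree_comp, natDegree_comp, ← hab] at this
    exact Nat.eq_of_mul_eq_mul_right ha this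
  have hla : a.leadingCoeff ≠ 0 := leadingCoeff_ne_zero.2 (by rintro rfl; simp at ha)
  have hlb : b.leadingCoeff ≠ 0 :=
    leadingCoeff_ne_zero.2 (by rintro rfl; rw [hab] at ha; simp at ha)
  set α := a.leadingCoeff / b.leadingCoeff with hα
  have hα0 : α ≠ 0 := div_ne_zero hla hlb
  have hyc : (y.comp (C α⁻¹ * X)).comp (C α * b) = y.comp b := by
    rw [comp_assoc]
    congr 1
    simp [← mul_assoc, ← C_mul, hα0]
  have hd1 : (C α⁻¹ * X : K[X]).natDegree = 1 := natDegree_C_mul_X _ (inv_ne_zero hα0)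
  have hdb : (C α * b).natDegree = b.natDegree := natDegree_C_mul hα0
  have hlead := congrArg leadingCoeff h
  rw [leadingCoeff_comp ha.ne', leadingCoeff_comp (hab ▸ ha.ne'), ← hxy] at hlead
  have h0 := natDegree_sub_eq_zero_of_comp_eq_comp (x := x) (y := y.comp (C α⁻¹ * X))
    (a := a) (b := C α * b) hx (by rw [natDegree_comp, hd1, mul_one, hxy])
    (by
      rw [leadingCoeff_comp (by rw [hd1]; exact one_ne_zero), leadingCoeff_mul, leadingCoeff_C,
        leadingCoeff_X, mul_one, ← hxy, hα, inv_div, div_pow, mul_div_assoc', ← hlead]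
      field_simp)
    ha (by rw [hdb, hab]) (by rw [leadingCoeff_mul, leadingCoeff_C, hα, div_mul_cancel₀ _ hlb])
    (by rw [hyc, h])
  refine ⟨α, (a - C α * b).coeff 0, ?_⟩
  rw [← eq_C_of_natDegree_eq_zero h0]
  ring

open Polynomial in
theorem isExceptional_of_eq_C_mul_X_sub_C_pow_add_C {P : ℂ[X]} {u c : ℂ} {n : ℕ} (hn : 2 ≤ n)
    (hu : u ≠ 0) (hP : P = C u * (X - C c) ^ n + C c) : IsExceptional P := by
  obtain ⟨A, hA⟩ := IsAlgClosed.exists_pow_nat_eq u (by omega : 0 < n - 1)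
  have hA0 : A ≠ 0 := by
    rintro rfl
    rw [zero_pow (by omega)] at hA
    exact hu hA.symm
  have hdeg : P.natDegree = n := by
    rw [hP, natDegree_add_C, natDegree_C_mul hu, natDegree_pow, natDegree_X_sub_C, mul_one]
  refine Or.inr ⟨A, -(A * c), hA0, Or.inl ?_⟩
  rw [hdeg]
  have h1 : A * u * A⁻¹ ^ n = 1 := by
    obtain ⟨k, rfl⟩ : ∃ k, n = k + 1 := ⟨n - 1, by omega⟩
    rw [← hA, inv_pow, Nat.add_sub_cancel, ← pow_succ', mul_inv_cancel₀ (pow_ne_zero _ hA0)]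
  have h2 : (C A⁻¹ * (X - C (-(A * c))) - C c : ℂ[X]) = C A⁻¹ * X := by
    have : C A⁻¹ * C A = (1 : ℂ[X]) := by rw [← C_mul, inv_mul_cancel₀ hA0, C_1]
    simp only [C_neg, C_mul]
    linear_combination C c * this
  have h3 : affConj A (-(A * c)) P =
      C A * (C u * (C A⁻¹ * (X - C (-(A * c))) - C c) ^ n + C c) + C (-(A * c)) := by
    rw [affConj, hP]
    simp
  rw [h3, h2, mul_pow, ← C_pow]
  have h4 : (C A * C u * C (A⁻¹ ^ n) : ℂ[X]) = 1 := by rw [← C_mul, ← C_mul, h1, C_1]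
  simp only [C_neg, C_mul]
  linear_combination X ^ n * h4

open Polynomial in
theorem exists_ne_critical_points_comp_self {P : ℂ[X]} (hP : ¬ IsExceptional P) :
    ∃ r s : ℂ, r ≠ s ∧ (P.comp P).derivative.IsRoot r ∧ (P.comp P).derivative.IsRoot s := by
  by_contra! hcon
  have hdeg : 2 ≤ P.natDegree := by
    by_contra hlt
    exact hP (Or.inl (by omega))
  have hroot : ∀ z, (P.comp P).derivative.IsRoot z ↔
      P.derivative.IsRoot z ∨ P.derivative.IsRoot (P.eval z) := fun z => by
    simp [derivative_comp, IsRoot.def, eval_mul, eval_comp]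
  obtain ⟨c, hc⟩ : ∃ c, P.derivative.IsRoot c := by
    refine IsAlgClosed.exists_root _ fun h0 => ?_
    have h1 := natDegree_derivative P
    rw [natDegree_eq_of_degree_eq_some h0] at h1
    change 0 = _ at h1
    omega
  have huniq : ∀ z, P.eval z = c → z = c := fun z hz => by
    by_contra hzc
    exact hcon z c hzc ((hroot z).2 (Or.inr (hz ▸ hc))) ((hroot c).2 (Or.inl hc))
  have hne : P - C c ≠ 0 := fun h0 => by
    rw [sub_eq_zero.1 h0, natDegree_C] at hdeg
    omega
  have hrep : (P - C c).roots = Multiset.replicate P.natDegree c := by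
    rw [Multiset.eq_replicate]
    refine ⟨?_, fun z hz => huniq z ?_⟩
    · rw [← natDegree_sub_C (p := P) (a := c)]
      exact (splits_iff_card_roots.1 (IsAlgClosed.splits _))
    · have := (mem_roots hne).1 hz
      rw [IsRoot.def, eval_sub, eval_C] at this
      exact sub_eq_zero.1 this
  have hprod := C_leadingCoeff_mul_prod_multiset_X_sub_C
    (splits_iff_card_roots.1 (IsAlgClosed.splits (P - C c)))
  rw [hrep, Multiset.map_replicate, Multiset.prod_replicate] at hprod
  exact hP (isExceptional_of_eq_C_mul_X_sub_C_pow_add_C hdeg (leadingCoeff_ne_zero.2 hne)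
    (by rw [hprod]; ring))

open Polynomial in
/-- If any two elements of the same degree have a common left multiple, then the number of
elements of a given degree is uniformly bounded. -/
theorem exists_card_bound_of_natDegree {S : Set ℂ[X]} (hdeg : ∀ p ∈ S, 0 < p.natDegree)
    (hcomp : ∀ p ∈ S, ∀ q ∈ S, p.comp q ∈ S) (hexc : ∃ P ∈ S, ¬ IsExceptional P)
    (hrev : ∀ a ∈ S, ∀ b ∈ S, ∃ x ∈ S, ∃ y ∈ S, x.comp a = y.comp b) :
    ∃ N : ℕ, ∀ n, ∃ F : Finset ℂ[X], F.card ≤ N ∧ ∀ p ∈ S, p.natDegree = n → p ∈ F := by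
  classical
  obtain ⟨P, hPS, hP⟩ := hexc
  have haff : ∀ a ∈ S, ∀ b ∈ S, a.natDegree = b.natDegree → ∃ α β : ℂ, a = C α * b + C β := by
    intro a ha b hb hab
    obtain ⟨x, hx, y, hy, h⟩ := hrev a ha b hb
    exact exists_eq_C_mul_add_C_of_comp_eq_comp (hdeg x hx) (hdeg a ha) hab h
  obtain ⟨r, s, hrs, hr, hs⟩ := exists_ne_critical_points_comp_self hP
  set Q := P.comp P with hQ
  have hQS : Q ∈ S := hcomp P hPS P hPS
  let R : Finset ℂ := Q.derivative.roots.toFinset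
  have hQ0 : Q.derivative ≠ 0 := fun h0 =>
    (hdeg Q hQS).ne' (derivative_eq_zero.1 h0)
  refine ⟨(R ×ˢ R).card, fun n => ?_⟩
  by_cases hn : ∃ b ∈ S, b.natDegree = n
  swap
  · exact ⟨∅, by simp, fun p hp hpn => (hn ⟨p, hp, hpn⟩).elim⟩
  obtain ⟨b, hb, rfl⟩ := hn
  refine ⟨(R ×ˢ R).image fun w => C ((w.1 - w.2) / (r - s)) * b +
    C (w.1 - (w.1 - w.2) / (r - s) * r), Finset.card_image_le, fun a ha hab => ?_⟩
  obtain ⟨α, β, h⟩ := haff a ha b hb hab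
  have hα : α ≠ 0 := by
    rintro rfl
    have := hdeg a ha
    rw [h] at this
    simp at this
  obtain ⟨α', β', h'⟩ := haff (Q.comp a) (hcomp Q hQS a ha) (Q.comp b) (hcomp Q hQS b hb)
    (by rw [natDegree_comp (p := Q), natDegree_comp (p := Q), hab])
  have hconj : Q.comp (C α * X + C β) = C α' * Q + C β' := by
    refine comp_right_injective (hdeg b hb) ?_
    simp only [comp_assoc, add_comp, mul_comp, C_comp, X_comp]
    rw [← h, h']
  have hder := congrArg derivative hconj
  have hroot : ∀ z, Q.derivative.IsRoot z → α * z + β ∈ R := fun z hz => by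
    have hev := congrArg (eval z) hder
    simp only [derivative_comp, derivative_add, derivative_mul, derivative_C, derivative_X,
      eval_mul, eval_add, eval_comp, eval_C, eval_X, eval_zero, eval_one, hz.eq_zero] at hev
    simp only [R, Multiset.mem_toFinset, mem_roots hQ0, IsRoot.def]
    have : α * eval (α * z + β) (derivative Q) = 0 := by linear_combination hev
    exact (mul_eq_zero.1 this).resolve_left hα
  refine Finset.mem_image.2 ⟨(α * r + β, α * s + β),
    Finset.mem_product.2 ⟨hroot r hr, hroot s hs⟩, ?_⟩
  have hsub : r - s ≠ 0 := sub_ne_zero.2 hrs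
  have e1 : (α * r + β - (α * s + β)) / (r - s) = α := by
    field_simp
    ring
  simp only [e1]
  rw [h, add_sub_cancel_left]

/-- A semigroup of nonconstant polynomials with uniformly boundedly many elements of each degree
is right amenable. -/
theorem exists_polyRightInv_of_card_bound {T : Set (Polynomial ℂ)} (hne : T.Nonempty)
    (hdeg : ∀ p ∈ T, 0 < p.natDegree) (hcomp : ∀ p ∈ T, ∀ q ∈ T, p.comp q ∈ T) (N : ℕ)
    (hN : ∀ n, ∃ F : Finset (Polynomial ℂ), F.card ≤ N ∧ ∀ p ∈ T, p.natDegree = n → p ∈ F) :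
    ∃ M : Mean T, PolyRightInv T M := by
  classical
  let r : T → T → T := fun h g => ⟨(g : Polynomial ℂ).comp h, hcomp _ g.2 _ h.2⟩
  suffices h : ∃ M : Mean T, ∀ h (f : T → ℝ), Bdd f → M.toFun (fun g => f (r h g)) = M.toFun f by
    obtain ⟨M, hM⟩ := h
    exact ⟨M, fun h _ f hf => hM h f hf⟩
  refine Mean.exists_invariant_of_folner r (fun h p q hpq => ?_) fun H₀ ε hε => ?_
  · exact Subtype.ext (Polynomial.comp_right_injective (hdeg h h.2) (congrArg Subtype.val hpq))
  obtain ⟨t, ht⟩ := hne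
  let H : Finset T := insert ⟨t, ht⟩ H₀
  let D : (H → ℕ) → ℕ := fun e => ∏ h : H, (h : Polynomial ℂ).natDegree ^ e h
  let A : ℕ → Finset ℕ := fun K => (Fintype.piFinset fun _ : H => Finset.range (K + 2)).image D
  choose B hBcard hB using hN
  have hcov : ∀ K, {g : T | (g : Polynomial ℂ).natDegree ∈ A K} ⊆
      Subtype.val ⁻¹' (((A K).biUnion B : Finset (Polynomial ℂ)) : Set (Polynomial ℂ)) :=
    fun K g hg => by
      simp only [Set.mem_preimage, Finset.mem_coe, Finset.mem_biUnion]
      exact ⟨_, hg, hB _ g g.2 rfl⟩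
  have hfin : ∀ K, {g : T | (g : Polynomial ℂ).natDegree ∈ A K}.Finite := fun K =>
    ((Finset.finite_toSet _).preimage Subtype.val_injective.injOn).subset (hcov K)
  let F : ℕ → Finset T := fun K => (hfin K).toFinset
  have hmemF : ∀ K (g : T), g ∈ F K ↔ (g : Polynomial ℂ).natDegree ∈ A K := fun K g => by
    simp [F]
  have hA : ∀ K d, d ∈ A K ↔ ∃ e : H → ℕ, (∀ h, e h < K + 2) ∧ D e = d := fun K d => by
    simp [A]
  have hmono : ∀ K, F K ⊆ F (K + 1) := fun K g hg => by
    rw [hmemF, hA] at hg ⊢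
    obtain ⟨e, he, hd⟩ := hg
    exact ⟨e, fun h => (he h).trans (by omega), hd⟩
  have hstep : ∀ (e : H → ℕ) (h : H),
      D (e + Pi.single h 1) = D e * (h : Polynomial ℂ).natDegree := fun e h => by
    simp only [D, Pi.add_apply, pow_add, Finset.prod_mul_distrib]
    congr 1
    rw [Finset.prod_eq_single h]
    · simp
    · intro j _ hj
      simp [Pi.single_eq_of_ne hj]
    · simp
  have hsingle : ∀ h j : H, (Pi.single h 1 : H → ℕ) j ≤ 1 := fun h j => by
    rw [Pi.single_apply]
    split_ifs <;> simp
  have hmul : ∀ K, ∀ h ∈ H, ∀ g ∈ F K, r h g ∈ F (K + 1) := fun K h hh g hg => by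
    rw [hmemF, hA] at hg ⊢
    obtain ⟨e, he, hd⟩ := hg
    refine ⟨e + Pi.single ⟨h, hh⟩ 1, fun j => ?_, ?_⟩
    · have := hsingle ⟨h, hh⟩ j
      have := he j
      simp only [Pi.add_apply]
      omega
    · rw [hstep, hd, Polynomial.natDegree_comp]
  have hFne : ∀ K, (F K).Nonempty := fun K => by
    refine ⟨⟨t, ht⟩, ?_⟩
    rw [hmemF, hA]
    refine ⟨0 + Pi.single ⟨⟨t, ht⟩, Finset.mem_insert_self _ _⟩ 1, fun j => ?_, ?_⟩
    · have := hsingle ⟨⟨t, ht⟩, Finset.mem_insert_self _ _⟩ j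
      simp only [Pi.add_apply, Pi.zero_apply]
      omega
    · rw [hstep]
      simp [D]
  have hcard : ∀ K, (F K).card ≤ N * (K + 2) ^ H.card := fun K => by
    have h1 : (F K).card ≤ ((A K).biUnion B).card :=
      Finset.card_le_card_of_injOn Subtype.val
        (fun g hg => hcov K ((hmemF K g).1 hg)) Subtype.val_injective.injOn
    have h2 : (A K).card ≤ (K + 2) ^ H.card := by
      refine Finset.card_image_le.trans ?_
      simp
    calc (F K).card ≤ (A K).card * N :=
          h1.trans (Finset.card_biUnion_le_card_mul _ _ _ fun n _ => hBcard n)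
      _ ≤ N * (K + 2) ^ H.card := by
          rw [mul_comm]
          exact Nat.mul_le_mul_left _ h2
  obtain ⟨K, hK⟩ := exists_succ_le_of_polynomial_growth (fun K => (F K).card)
    (fun K => (hFne K).card_pos) N H.card hcard ε hε
  exact ⟨F K, F (K + 1), hFne K, hmono K,
    fun h hh => hmul K h (Finset.mem_insert_of_mem hh), hK⟩

theorem PolyGen.mem_of_subset {G S : Set (Polynomial ℂ)} (hG : G ⊆ S)
    (hcomp : ∀ p ∈ S, ∀ q ∈ S, p.comp q ∈ S) {p : Polynomial ℂ} (hp : PolyGen G p) : p ∈ S := by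
  induction hp with
  | base hp => exact hG hp
  | comp _ _ ihp ihq => exact hcomp _ ihp _ ihq

/-- For a non-exceptional semigroup `S` of (nonconstant complex) polynomials, the
following are equivalent: (1) `S` is right amenable; (2) every subsemigroup of `S`
is right amenable; (3) every subsemigroup of `S` generated by two elements is right
amenable. -/
theorem right_amenable_hereditary_characterization
    (S : Set (Polynomial ℂ)) (hne : S.Nonempty)
    (hdeg : ∀ p ∈ S, 0 < p.natDegree)
    (hcomp : ∀ p ∈ S, ∀ q ∈ S, p.comp q ∈ S)
    (hexc : ∃ P ∈ S, ¬ IsExceptional P) :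
    ((∃ M : Mean S, PolyRightInv S M) ↔
      (∀ T : Set (Polynomial ℂ), T ⊆ S → T.Nonempty →
        (∀ p ∈ T, ∀ q ∈ T, p.comp q ∈ T) → ∃ M : Mean T, PolyRightInv T M)) ∧
    ((∃ M : Mean S, PolyRightInv S M) ↔
      (∀ a ∈ S, ∀ b ∈ S, ∃ M : Mean (setOf (PolyGen {a, b})),
        PolyRightInv (setOf (PolyGen {a, b})) M)) := by
  have hereditary : (∀ a ∈ S, ∀ b ∈ S, ∃ x ∈ S, ∃ y ∈ S, x.comp a = y.comp b) →
      ∀ T : Set (Polynomial ℂ), T ⊆ S → T.Nonempty →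
        (∀ p ∈ T, ∀ q ∈ T, p.comp q ∈ T) → ∃ M : Mean T, PolyRightInv T M := by
    intro hrev T hTS hT hTc
    obtain ⟨N, hN⟩ := exists_card_bound_of_natDegree hdeg hcomp hexc hrev
    refine exists_polyRightInv_of_card_bound hT (fun p hp => hdeg p (hTS hp)) hTc N fun n => ?_
    obtain ⟨F, hF, hmem⟩ := hN n
    exact ⟨F, hF, fun p hp => hmem p (hTS hp)⟩
  have hgen : ∀ a ∈ S, ∀ b ∈ S, ∀ p, PolyGen {a, b} p → p ∈ S :=
    fun a ha b hb p hp =>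
    PolyGen.mem_of_subset (Set.pair_subset ha hb) hcomp hp
  have hamen : (∃ M : Mean S, PolyRightInv S M) →
      ∀ T : Set (Polynomial ℂ), T ⊆ S → T.Nonempty →
        (∀ p ∈ T, ∀ q ∈ T, p.comp q ∈ T) → ∃ M : Mean T, PolyRightInv T M := fun ⟨M, hM⟩ =>
    hereditary fun a ha b hb => hM.exists_comp_eq_comp hcomp ha hb
  refine ⟨⟨hamen, fun h => h S subset_rfl hne hcomp⟩, ⟨fun h a ha b hb => ?_, fun h => ?_⟩⟩
  · exact hamen h _ (hgen a ha b hb) ⟨a, .base (by simp)⟩ fun p hp q hq => .comp hp hq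
  · refine hereditary (fun a ha b hb => ?_) S subset_rfl hne hcomp
    obtain ⟨M, hM⟩ := h a ha b hb
    obtain ⟨x, hx, y, hy, hxy⟩ := hM.exists_comp_eq_comp (fun p hp q hq => .comp hp hq)
      (.base (by simp) : PolyGen {a, b} a) (.base (by simp) : PolyGen {a, b} b)
    exact ⟨x, hgen a ha b hb x hx, y, hgen a ha b hb y hy, hxy⟩
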